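/- arXiv:2303.12713 — 4 statements merged into one kernel-verified Lean document; each statement's English description precedes it below -/
import Mathlib

section
/- For every m ≥ 2, every row of CT_m is a row of the Sylvester Hadamard matrix H_{2^{m-1}}; moreover distinct rows of CT_m are distinct rows of H_{2^{m-1}}. Precisely, with e_1 = 0 and e_k = 2^{k-2} for 2 ≤ k ≤ m, the row of CT_m at position (j-1)(j-2)/2 + i (for 1 ≤ i < j ≤ m) equals row number (e_i XOR e_j) of H_{2^{m-1}} (rows 0-indexed), and the map (i,j) ↦ e_i XOR e_j is injective on pairs i < j. -/
open Matrix
open scoped Classical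

/-- `pidx i j` is the 0-indexed position of the pair `(i,j)`, `i < j`, in the standard
ordering `(0,1),(0,2),(1,2),(0,3),...`; it corresponds to the 1-indexed position
`(j-1)(j-2)/2 + i` of the paper (for 1-indexed pairs `1 ≤ i < j ≤ m`). -/
def pidx (i j : ℕ) : ℕ := j * (j - 1) / 2 + i

lemma pidx_lt {i j m : ℕ} (hij : i < j) (hjm : j < m) : pidx i j < m * (m - 1) / 2 := by
  have h1 : pidx i j < j * (j - 1) / 2 + j := by unfold pidx; omega
  have h2 : j * (j - 1) / 2 + j = (j + 1) * j / 2 := by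
    obtain ⟨j', rfl⟩ : ∃ j', j = j' + 1 := ⟨j - 1, by omega⟩
    have h : (j' + 2) * (j' + 1) = (j' + 1) * j' + (j' + 1) * 2 := by ring
    simp only [Nat.add_sub_cancel]
    rw [show j' + 1 + 1 = j' + 2 from rfl, h,
      Nat.add_mul_div_right _ _ (by norm_num : 0 < 2)]
  have h3 : (j + 1) * j ≤ m * (m - 1) := Nat.mul_le_mul (by omega) (by omega)
  have h4 := Nat.div_le_div_right (c := 2) h3
  omega

/-- `T_m`: the `m × 2^(m-1)` matrix whose columns are exactly the `2^(m-1)` vectors of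
the form `(1, ±1, …, ±1)`: `T_m(0,j) = 1` and `T_m(i,j) = (-1)^(bit_(i-1)(j))` for
`i ≥ 1`. -/
def Tmat (m : ℕ) : Matrix (Fin m) (Fin (2 ^ (m - 1))) ℝ :=
  fun i j => if i.val = 0 then 1 else if Nat.testBit j.val (i.val - 1) then -1 else 1

/-- The Sylvester Hadamard matrix `H_{2^k}`, via `H(i,j) = (-1)^popcount(i AND j)`
(the sum of the binary digits of `i &&& j` is its popcount). -/
def Hsyl (k : ℕ) : Matrix (Fin (2 ^ k)) (Fin (2 ^ k)) ℝ :=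
  fun i j => (-1) ^ ((Nat.digits 2 (i.val &&& j.val)).sum)

/-- `CT_m`: the `(m(m-1)/2) × 2^(m-1)` matrix whose `k`-th column is the Column
Pairwise Product of the `k`-th column of `T_m`: its entry in the row at position
`pidx i j` (for the unique pair `i < j` with that position) and column `k` is
`T_m i k * T_m j k`. -/
def CTmat (m : ℕ) : Matrix (Fin (m * (m - 1) / 2)) (Fin (2 ^ (m - 1))) ℝ :=
  fun p k => ∑ i : Fin m, ∑ j : Fin m,
    if i < j ∧ pidx i.val j.val = p.val then Tmat m i k * Tmat m j k else 0

/-- `evec m` sends row index `0` of `T_m` to `0` and row index `i ≥ 1` to `2^(i-1)`: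
these are the row indices of `H_{2^(m-1)}` occupied by the rows of `T_m`. -/
def evec (m : ℕ) (i : Fin m) : ℕ := if i.val = 0 then 0 else 2 ^ (i.val - 1)

lemma evec_lt {m : ℕ} (i : Fin m) : evec m i < 2 ^ (m - 1) := by
  unfold evec
  split_ifs with h
  · positivity
  · exact Nat.pow_lt_pow_right (by norm_num) (by have := i.isLt; omega)

/-- A pair `i < j` is determined by its position. -/
lemma pidx_inj {i j i' j' : ℕ} (h : i < j) (h' : i' < j') (e : pidx i j = pidx i' j') :
    i = i' ∧ j = j' := by
  rcases lt_trichotomy j j' with hj | rfl | hj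
  · have := pidx_lt h hj
    unfold pidx at *
    omega
  · unfold pidx at e
    omega
  · have := pidx_lt h' hj
    unfold pidx at *
    omega

lemma CTmat_apply_pidx {m : ℕ} {i j : Fin m} (h : i < j) (k : Fin (2 ^ (m - 1))) :
    CTmat m ⟨pidx i j, pidx_lt h j.isLt⟩ k = Tmat m i k * Tmat m j k := by
  have key (a b : Fin m) : (a < b ∧ pidx a b = pidx i j) ↔ (a = i ∧ b = j) := by
    constructor
    · rintro ⟨hab, e⟩
      have := pidx_inj hab h e
      exact ⟨Fin.ext this.1, Fin.ext this.2⟩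
    · rintro ⟨rfl, rfl⟩
      exact ⟨h, rfl⟩
  simp only [CTmat, key, ite_and]
  simp

/-- The sign `(-1) ^ popcount n`. -/
def popcountSign (n : ℕ) : ℝ := (-1) ^ (Nat.digits 2 n).sum

lemma popcountSign_zero : popcountSign 0 = 1 := by simp [popcountSign]

lemma popcountSign_eq (n : ℕ) : popcountSign n = (-1) ^ (n % 2) * popcountSign (n / 2) := by
  rcases Nat.eq_zero_or_pos n with rfl | hn
  · simp [popcountSign]
  · rw [popcountSign, Nat.digits_def' (by norm_num) hn, List.sum_cons, pow_add, popcountSign]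

lemma popcountSign_xor (a b : ℕ) :
    popcountSign (a ^^^ b) = popcountSign a * popcountSign b := by
  induction a using Nat.strong_induction_on generalizing b with
  | _ a ih =>
    rcases Nat.eq_zero_or_pos a with rfl | ha
    · simp [popcountSign_zero]
    · rw [popcountSign_eq (a ^^^ b), popcountSign_eq a, popcountSign_eq b, Nat.xor_div_two,
        ih _ (Nat.div_lt_self ha (by norm_num))]
      have hbit : (-1 : ℝ) ^ ((a ^^^ b) % 2) = (-1) ^ (a % 2) * (-1) ^ (b % 2) := by
        simp only [Nat.xor_mod_two_eq, ← neg_one_pow_eq_pow_mod_two, pow_add]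
      rw [hbit]
      ring

lemma popcountSign_two_pow (n : ℕ) : popcountSign (2 ^ n) = -1 := by
  induction n with
  | zero => simp [popcountSign]
  | succ n ih => rw [popcountSign_eq, pow_succ]; simp [ih]

lemma Tmat_eq_popcountSign {m : ℕ} (i : Fin m) (k : Fin (2 ^ (m - 1))) :
    Tmat m i k = popcountSign (evec m i &&& k.val) := by
  unfold Tmat evec
  split_ifs with h hk
  · simp [popcountSign_zero]
  · simp [Nat.two_pow_and, hk, popcountSign_two_pow]
  · simp [Nat.two_pow_and, hk, popcountSign_zero]

lemma testBit_evec {m : ℕ} (i : Fin m) (t : ℕ) :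
    (evec m i).testBit t = decide (i.val = t + 1) := by
  unfold evec
  split_ifs with h
  · simp [h]
  · rw [Nat.testBit_two_pow]
    exact decide_eq_decide.mpr (by omega)

lemma evec_xor_inj {m : ℕ} {i j i' j' : Fin m} (h : i < j) (h' : i' < j')
    (e : evec m i ^^^ evec m j = evec m i' ^^^ evec m j') : i = i' ∧ j = j' := by
  have key (t : ℕ) : (i.val = t + 1 ↔ ¬ j.val = t + 1) ↔ (i'.val = t + 1 ↔ ¬ j'.val = t + 1) := by
    have := congrArg (Nat.testBit · t) e
    simp only [Nat.testBit_xor, testBit_evec] at this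
    grind
  have hi := key (i.val - 1)
  have hj := key (j.val - 1)
  have hi' := key (i'.val - 1)
  have hj' := key (j'.val - 1)
  rw [Fin.lt_def] at h h'
  rw [Fin.ext_iff, Fin.ext_iff]
  omega

/-- For every `m ≥ 2`, every row of `CT_m` is a row of the Sylvester Hadamard matrix
`H_(2^(m-1))`, and distinct rows of `CT_m` are distinct rows of `H_(2^(m-1))`: with
`e 0 = 0` and `e i = 2^(i-1)` for `i ≥ 1`, the row of `CT_m` at the position of the
pair `i < j` is row `e i XOR e j` of `H_(2^(m-1))`, and `(i,j) ↦ e i XOR e j` is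
injective on pairs `i < j`. -/
theorem CTmat_rows_are_Hsyl_rows (m : ℕ) (hm : 2 ≤ m) :
    (∀ (i j : Fin m) (h : i < j),
      CTmat m ⟨pidx i j, pidx_lt h j.isLt⟩ =
        Hsyl (m - 1)
          ⟨evec m i ^^^ evec m j, Nat.xor_lt_two_pow (evec_lt i) (evec_lt j)⟩) ∧
    (∀ i j i' j' : Fin m, i < j → i' < j' →
      evec m i ^^^ evec m j = evec m i' ^^^ evec m j' → i = i' ∧ j = j') := by
  refine ⟨fun i j h => ?_, fun i j i' j' h h' e => evec_xor_inj h h' e⟩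
  funext k
  rw [CTmat_apply_pidx h, Tmat_eq_popcountSign, Tmat_eq_popcountSign, ← popcountSign_xor,
    ← Nat.and_xor_distrib_right]
  rfl
end

section
/- Let m ≥ 2, let M be an m × n m-Hadamardesque matrix with Column Representation Vector v ∈ ℝ^{2^{m-1}}, and let 1 ≤ i < j ≤ m. Then the dot product of the i-th and j-th rows of M equals the dot product of v with the row of CT_m at position (j-1)(j-2)/2 + i. -/
open Matrix
open scoped Classical

/-- An `m × n` real matrix is `m`-Hadamardesque if every column is a positive multiple
of some column of `T_m`. -/
def IsHadamardesque {m n : ℕ} (M : Matrix (Fin m) (Fin n) ℝ) : Prop :=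
  ∀ k : Fin n, ∃ (p : ℝ) (c : Fin (2 ^ (m - 1))), 0 < p ∧ ∀ i, M i k = p * Tmat m i c

/-- The Column Representation Vector of an (`m`-Hadamardesque) matrix `M`: its `c`-th
coordinate is the sum of `p²` over all columns of `M` equal to `p` times the `c`-th
column of `T_m` with `p > 0` (for such a column, `p` is its first entry, since the
first entry of each column of `T_m` is `1`), and `0` if no column of `M` is a positive
multiple of the `c`-th column of `T_m`. -/
noncomputable def CRV {m n : ℕ} (hm : 0 < m) (M : Matrix (Fin m) (Fin n) ℝ) :
    Fin (2 ^ (m - 1)) → ℝ :=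
  fun c => ∑ k : Fin n,
    if 0 < M ⟨0, hm⟩ k ∧ ∀ i, M i k = M ⟨0, hm⟩ k * Tmat m i c then (M ⟨0, hm⟩ k) ^ 2
    else 0

/-- `RC_m`: the set of rows of `H_{2^(m-1)}` that are not rows of `CT_m`. -/
def RCset (m : ℕ) : Set (Fin (2 ^ (m - 1)) → ℝ) :=
  {w | (∃ a : Fin (2 ^ (m - 1)), w = Hsyl (m - 1) a) ∧
       ¬∃ p : Fin (m * (m - 1) / 2), w = CTmat m p}

lemma pidx_injective {i j i' j' : ℕ} (h : i < j) (h' : i' < j')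
    (he : pidx i j = pidx i' j') : i = i' ∧ j = j' := by
  have hj : j = j' := by
    rcases lt_trichotomy j j' with hlt | heq | hgt
    · have := pidx_lt h hlt
      unfold pidx at he this
      omega
    · exact heq
    · have := pidx_lt h' hgt
      unfold pidx at he this
      omega
  subst hj
  unfold pidx at he
  exact ⟨by omega, rfl⟩

lemma CTmat_pidx {m : ℕ} {i j : Fin m} (h : i < j) (c : Fin (2 ^ (m - 1))) :
    CTmat m ⟨pidx i j, pidx_lt h j.isLt⟩ c = Tmat m i c * Tmat m j c := by
  have key (a b : Fin m) : (a < b ∧ pidx a.val b.val = pidx i j) ↔ a = i ∧ b = j := by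
    constructor
    · rintro ⟨hab, he⟩
      obtain ⟨h1, h2⟩ := pidx_injective hab h he
      exact ⟨Fin.ext h1, Fin.ext h2⟩
    · rintro ⟨rfl, rfl⟩
      exact ⟨h, rfl⟩
  simp only [CTmat, key, ite_and]
  simp

lemma Tmat_zero {m : ℕ} (hm : 0 < m) (c : Fin (2 ^ (m - 1))) : Tmat m ⟨0, hm⟩ c = 1 := by
  simp [Tmat]

lemma Tmat_col_injective {m : ℕ} {c d : Fin (2 ^ (m - 1))}
    (h : ∀ i, Tmat m i c = Tmat m i d) : c = d := by
  refine Fin.ext (Nat.eq_of_testBit_eq fun b => ?_)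
  by_cases hb : b < m - 1
  · have hi := h ⟨b + 1, by omega⟩
    simp only [Tmat, Nat.add_sub_cancel, Nat.add_eq_zero_iff, one_ne_zero, and_false,
      if_false] at hi
    cases hc : c.val.testBit b <;> cases hd : d.val.testBit b <;>
      first | rfl | norm_num [hc, hd] at hi
  · have hle : 2 ^ (m - 1) ≤ 2 ^ b := Nat.pow_le_pow_right (by norm_num) (by omega)
    rw [Nat.testBit_eq_false_of_lt (c.isLt.trans_le hle),
      Nat.testBit_eq_false_of_lt (d.isLt.trans_le hle)]

/-- For `m ≥ 2`, an `m`-Hadamardesque matrix `M` with Column Representation Vector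
`v`, and a pair `i < j`, the dot product of the `i`-th and `j`-th rows of `M` equals
the dot product of `v` with the row of `CT_m` at the position of the pair `(i,j)`. -/
theorem rowdot_eq_crv_dot_CTmat_row (m n : ℕ) (hm : 2 ≤ m)
    (M : Matrix (Fin m) (Fin n) ℝ) (hM : IsHadamardesque M)
    (i j : Fin m) (h : i < j) :
    M i ⬝ᵥ M j = CRV (by omega) M ⬝ᵥ CTmat m ⟨pidx i j, pidx_lt h j.isLt⟩ := by
  have hm0 : 0 < m := by omega
  simp only [dotProduct, CTmat_pidx h, CRV, Finset.sum_mul]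
  rw [Finset.sum_comm]
  refine Finset.sum_congr rfl fun k _ => ?_
  obtain ⟨p, c, hp, hc⟩ := hM k
  have h0 : M ⟨0, hm0⟩ k = p := by rw [hc, Tmat_zero, mul_one]
  have key (d : Fin (2 ^ (m - 1))) :
      (0 < M ⟨0, hm0⟩ k ∧ ∀ i, M i k = M ⟨0, hm0⟩ k * Tmat m i d) ↔ d = c := by
    rw [h0]
    constructor
    · rintro ⟨-, hd⟩
      exact Tmat_col_injective fun i => mul_left_cancel₀ hp.ne' ((hd i).symm.trans (hc i))
    · rintro rfl
      exact ⟨hp, hc⟩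
  simp only [key, ite_mul, zero_mul, Finset.sum_ite_eq', Finset.mem_univ, if_true]
  rw [h0, hc i, hc j]
  ring
end

section
/- Let m ≥ 2. For every vector a ∈ ℝ^{m(m-1)/2} there exist n ∈ ℕ and an m × n m-Hadamardesque matrix M such that for all 1 ≤ i < j ≤ m, the dot product of the i-th and j-th rows of M equals the coordinate of a at position (j-1)(j-2)/2 + i. -/
open Matrix
open scoped Classical

/-- The real value of the `i`-th entry of a sign vector. -/
def signVal {m : ℕ} (ε : Fin m → ℤˣ) (i : Fin m) : ℝ := ((ε i : ℤ) : ℝ)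

lemma signVal_eq_one_or {m : ℕ} (ε : Fin m → ℤˣ) (i : Fin m) :
    signVal ε i = 1 ∨ signVal ε i = -1 := by
  rcases Int.units_eq_one_or (ε i) with h | h <;> simp [signVal, h]

lemma signVal_mul_self {m : ℕ} (ε : Fin m → ℤˣ) (i : Fin m) :
    signVal ε i * signVal ε i = 1 := by
  rcases signVal_eq_one_or ε i with h | h <;> simp [h]

lemma signVal_flip_self {m : ℕ} (ε : Fin m → ℤˣ) (i : Fin m) :
    signVal (Pi.mulSingle i (-1) * ε) i = -signVal ε i := by
  simp [signVal]

lemma signVal_flip_of_ne {m : ℕ} (ε : Fin m → ℤˣ) {i k : Fin m} (h : k ≠ i) :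
    signVal (Pi.mulSingle i (-1) * ε) k = signVal ε k := by
  simp [signVal, h]

/-- A function that is odd in one of the signs sums to zero over all sign vectors. -/
lemma sum_eq_zero_of_flip {m : ℕ} (f : (Fin m → ℤˣ) → ℝ) (i : Fin m)
    (hf : ∀ ε, f (Pi.mulSingle i (-1) * ε) = -f ε) : ∑ ε, f ε = 0 := by
  have h := Equiv.sum_comp (Equiv.mulLeft (Pi.mulSingle i (-1) : Fin m → ℤˣ)) f
  simp only [Equiv.coe_mulLeft, hf, Finset.sum_neg_distrib] at h
  linarith

lemma sum_signVal_mul {m : ℕ} {i j : Fin m} (hij : i < j) :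
    ∑ ε : Fin m → ℤˣ, signVal ε i * signVal ε j = 0 := by
  refine sum_eq_zero_of_flip _ i fun ε => ?_
  rw [signVal_flip_self, signVal_flip_of_ne ε hij.ne', neg_mul]

lemma sum_signVal_mul_mul {m : ℕ} {i j k l : Fin m} (hij : i < j) (hkl : k < l) :
    ∑ ε : Fin m → ℤˣ, signVal ε k * signVal ε l * (signVal ε i * signVal ε j) =
      if k = i ∧ l = j then 2 ^ m else 0 := by
  split_ifs with h
  · obtain ⟨rfl, rfl⟩ := h
    have (ε : Fin m → ℤˣ) :
        signVal ε k * signVal ε l * (signVal ε k * signVal ε l) = 1 := by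
      rw [mul_mul_mul_comm, signVal_mul_self, signVal_mul_self, one_mul]
    simp [this]
  · by_cases hi : k ≠ i ∧ l ≠ i
    · refine sum_eq_zero_of_flip _ i fun ε => ?_
      rw [signVal_flip_self, signVal_flip_of_ne ε hij.ne', signVal_flip_of_ne ε hi.1,
        signVal_flip_of_ne ε hi.2]
      ring
    · have hj : k ≠ j ∧ l ≠ j := by grind
      refine sum_eq_zero_of_flip _ j fun ε => ?_
      rw [signVal_flip_self, signVal_flip_of_ne ε hij.ne, signVal_flip_of_ne ε hj.1,
        signVal_flip_of_ne ε hj.2]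
      ring

/-- Normalizing a sign vector to have first entry `1` gives a column of `Tmat m`. -/
lemma exists_Tmat_col {m : ℕ} (hm : 0 < m) (ε : Fin m → ℤˣ) :
    ∃ c, ∀ i, Tmat m i c = signVal ε ⟨0, hm⟩ * signVal ε i := by
  let b : Fin (m - 1) → Bool := fun r => decide (ε ⟨r + 1, by omega⟩ ≠ ε ⟨0, hm⟩)
  refine ⟨⟨Nat.ofBits b, Nat.ofBits_lt_two_pow b⟩, fun i => ?_⟩
  obtain ⟨i, hi⟩ := i
  rcases i with _ | i
  · simp [Tmat, signVal_mul_self]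
  · have hb := Nat.testBit_ofBits_lt b i (by omega)
    simp only [Tmat, Nat.add_sub_cancel, hb, b, signVal]
    rcases Int.units_eq_one_or (ε ⟨0, hm⟩) with h | h <;>
      rcases Int.units_eq_one_or (ε ⟨i + 1, hi⟩) with h' | h' <;> simp [h, h']

/-- A positive weight on sign vectors with prescribed second moments `A i j`, `i < j`. -/
lemma exists_weight {m : ℕ} (A : Fin m → Fin m → ℝ) (hA : ∀ k l, ¬ k < l → A k l = 0) :
    ∃ w : (Fin m → ℤˣ) → ℝ, (∀ ε, 0 < w ε) ∧
      ∀ i j, i < j → ∑ ε, w ε * (signVal ε i * signVal ε j) = A i j := by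
  refine ⟨fun ε => (1 + ∑ k, ∑ l, |A k l| / 2 ^ m) +
    ∑ k, ∑ l, A k l / 2 ^ m * (signVal ε k * signVal ε l), fun ε => ?_, fun i j hij => ?_⟩
  · beta_reduce
    rw [add_assoc, ← Finset.sum_add_distrib]
    refine add_pos_of_pos_of_nonneg one_pos (Finset.sum_nonneg fun k _ => ?_)
    rw [← Finset.sum_add_distrib]
    refine Finset.sum_nonneg fun l _ => ?_
    have h : |A k l / 2 ^ m * (signVal ε k * signVal ε l)| = |A k l| / 2 ^ m := by
      rcases signVal_eq_one_or ε k with h | h <;> rcases signVal_eq_one_or ε l with h' | h' <;>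
        simp [h, h', abs_div]
    linarith [neg_abs_le (A k l / 2 ^ m * (signVal ε k * signVal ε l))]
  · simp only [add_mul _ _ (signVal _ i * signVal _ j), Finset.sum_add_distrib,
      ← Finset.mul_sum, sum_signVal_mul hij, mul_zero, zero_add]
    simp only [Finset.sum_mul]
    rw [Finset.sum_comm]
    have key (k l : Fin m) : ∑ ε : Fin m → ℤˣ,
        A k l / 2 ^ m * (signVal ε k * signVal ε l) * (signVal ε i * signVal ε j) =
          if k = i then if l = j then A i j else 0 else 0 := by
      by_cases hkl : k < l
      · simp only [mul_assoc (A k l / 2 ^ m), ← Finset.mul_sum, sum_signVal_mul_mul hij hkl]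
        by_cases hk : k = i <;> by_cases hl : l = j <;> simp [hk, hl]
      · rw [hA k l hkl]
        have : ¬ (k = i ∧ l = j) := by grind
        by_cases hk : k = i <;> by_cases hl : l = j <;> simp_all
    calc _ = ∑ k, ∑ l, if k = i then if l = j then A i j else 0 else 0 :=
          Finset.sum_congr rfl fun k _ => by
            rw [Finset.sum_comm]
            exact Finset.sum_congr rfl fun l _ => key k l
      _ = A i j := by
        rw [Finset.sum_eq_single i] <;> simp +contextual

/-- For `m ≥ 2` and every `a ∈ ℝ^(m(m-1)/2)`, there is an `m × n` `m`-Hadamardesque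
matrix `M` whose pairwise row dot products realize `a`: for all pairs `i < j`, the dot
product of the `i`-th and `j`-th rows of `M` is the coordinate of `a` at the position
of the pair `(i,j)`. -/
theorem exists_hadamardesque_with_prescribed_rowdots (m : ℕ) (hm : 2 ≤ m)
    (a : Fin (m * (m - 1) / 2) → ℝ) :
    ∃ (n : ℕ) (M : Matrix (Fin m) (Fin n) ℝ), IsHadamardesque M ∧
      ∀ (i j : Fin m) (h : i < j), M i ⬝ᵥ M j = a ⟨pidx i j, pidx_lt h j.isLt⟩ := by
  have hm0 : 0 < m := by omega
  obtain ⟨w, hw, hwA⟩ := exists_weight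
    (fun i j : Fin m => if h : i < j then a ⟨pidx i j, pidx_lt h j.isLt⟩ else 0)
    (fun k l h => dif_neg h)
  choose c hc using exists_Tmat_col hm0
  let e := Fintype.equivFin (Fin m → ℤˣ)
  refine ⟨_, fun i k => √(w (e.symm k)) * Tmat m i (c (e.symm k)),
    fun k => ⟨_, _, Real.sqrt_pos.2 (hw _), fun i => rfl⟩, fun i j h => ?_⟩
  have h' := hwA i j h
  rw [dif_pos h] at h'
  rw [← h', ← Equiv.sum_comp e.symm]
  refine Finset.sum_congr rfl fun k _ => ?_
  beta_reduce
  rw [hc, hc, mul_mul_mul_comm, Real.mul_self_sqrt (hw _).le, mul_mul_mul_comm,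
    signVal_mul_self, one_mul]
end

section
/- Let m ≥ 2. For every vector a ∈ ℚ^{m(m-1)/2} there exist n ∈ ℕ, a positive rational number r, and an m × n matrix M all of whose entries belong to {r, -r}, whose first row is constantly r (so M is m-Hadamardesque), such that for all 1 ≤ i < j ≤ m, the dot product of the i-th and j-th rows of M equals the coordinate of a at position (j-1)(j-2)/2 + i. -/
open Matrix
open scoped Classical

/-- Flipping one coordinate shows that a function on sign vectors which is odd in that coordinate
sums to zero. -/
lemma sum_signs_eq_zero_of_odd {ι : Type*} [Fintype ι] [DecidableEq ι] (k : ι)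
    (f : (ι → ℤˣ) → ℤ) (hf : ∀ s, f (Function.update s k (-s k)) = -f s) :
    ∑ s, f s = 0 := by
  have hinv : Function.Involutive fun s : ι → ℤˣ => Function.update s k (-s k) := by
    intro s
    simp
  have h : ∑ s, f (Function.update s k (-s k)) = ∑ s, f s := hinv.bijective.sum_comp f
  simp only [hf, Finset.sum_neg_distrib] at h
  omega

lemma sum_signs_mul_eq_zero {ι : Type*} [Fintype ι] [DecidableEq ι] {i j : ι} (hij : i ≠ j) :
    ∑ s : ι → ℤˣ, ((s i : ℤ) * s j) = 0 := by
  refine sum_signs_eq_zero_of_odd i _ fun s => ?_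
  simp [Function.update_of_ne hij.symm]

/-- Distinct quadratic monomials in independent signs are orthogonal. -/
lemma sum_signs_mul_mul_mul {ι : Type*} [Fintype ι] [LinearOrder ι] {i j p q : ι}
    (hij : i < j) (hpq : p < q) :
    ∑ s : ι → ℤˣ, (((s p : ℤ) * s q) * (s i * s j)) =
      if p = i ∧ q = j then 2 ^ Fintype.card ι else 0 := by
  split_ifs with h
  · obtain ⟨rfl, rfl⟩ := h
    have hs : ∀ s : ι → ℤˣ, (((s p : ℤ) * s q) * (s p * s q)) = 1 := by
      intro s
      rw [mul_mul_mul_comm, ← Units.val_mul, ← Units.val_mul, Int.units_mul_self,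
        Int.units_mul_self]
      rfl
    simp only [hs]
    simp
  · by_cases hi : i = p ∨ i = q
    · have hjp : p ≠ j := by rintro rfl; rcases hi with rfl | rfl <;> order
      have hjq : q ≠ j := by rintro rfl; rcases hi with rfl | rfl <;> simp_all
      refine sum_signs_eq_zero_of_odd j _ fun s => ?_
      simp [Function.update_of_ne hjp, Function.update_of_ne hjq, Function.update_of_ne hij.ne]
    · push Not at hi
      refine sum_signs_eq_zero_of_odd i _ fun s => ?_
      simp [Function.update_of_ne hi.1.symm, Function.update_of_ne hi.2.symm,
        Function.update_of_ne hij.ne']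

/-- Any integral prescription, scaled by `2 ^ m`, is realized as the pairwise correlations of a
nonnegative integral weight on sign vectors. -/
lemma exists_weight_signs {ι : Type*} [Fintype ι] [LinearOrder ι] (b : ι → ι → ℤ) :
    ∃ w : (ι → ℤˣ) → ℕ, ∀ i j, i < j →
      ∑ s, (w s : ℤ) * ((s i : ℤ) * s j) = 2 ^ Fintype.card ι * b i j := by
  let P : Finset (ι × ι) := Finset.univ.filter fun x => x.1 < x.2
  let v : (ι → ℤˣ) → ℤ := fun s =>
    ∑ x ∈ P, |b x.1 x.2| + ∑ x ∈ P, b x.1 x.2 * ((s x.1 : ℤ) * s x.2)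
  have hv : ∀ s, 0 ≤ v s := by
    intro s
    simp only [v, ← Finset.sum_add_distrib]
    refine Finset.sum_nonneg fun x _ => ?_
    have h := neg_abs_le (b x.1 x.2 * ((s x.1 : ℤ) * s x.2))
    rw [abs_mul, ← Units.val_mul, Int.isUnit_iff_abs_eq.mp (s x.1 * s x.2).isUnit] at h
    push_cast at h
    linarith
  refine ⟨fun s => (v s).toNat, fun i j hij => ?_⟩
  simp only [Int.toNat_of_nonneg (hv _)]
  simp only [v, add_mul, Finset.sum_add_distrib, ← Finset.mul_sum, sum_signs_mul_eq_zero hij.ne,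
    mul_zero, zero_add]
  simp only [Finset.sum_mul]
  rw [Finset.sum_comm]
  simp only [mul_assoc (b _ _), ← Finset.mul_sum]
  rw [Finset.sum_eq_single (i, j)]
  · rw [sum_signs_mul_mul_mul hij hij, if_pos ⟨rfl, rfl⟩, mul_comm]
  · rintro ⟨p, q⟩ hx hne
    rw [sum_signs_mul_mul_mul hij (by simpa [P] using hx), if_neg, mul_zero]
    rintro ⟨rfl, rfl⟩
    exact hne rfl
  · intro h
    simp [P, hij] at h

/-- Every sign vector with first entry `1` is a column of `T_m`. -/
lemma exists_Tmat_column {m : ℕ} (t : Fin m → ℤˣ) (ht : ∀ i : Fin m, i.val = 0 → t i = 1) :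
    ∃ c, ∀ i, Tmat m i c = ((t i : ℤ) : ℝ) := by
  refine ⟨⟨Nat.ofBits fun k : Fin (m - 1) => decide (t ⟨k.val + 1, by omega⟩ = -1),
    Nat.ofBits_lt_two_pow _⟩, fun i => ?_⟩
  unfold Tmat
  by_cases hi : i.val = 0
  · simp [hi, ht i hi]
  · rw [if_neg hi, Nat.testBit_ofBits_lt _ _ (by omega)]
    have hi' : (⟨i.val - 1 + 1, by omega⟩ : Fin m) = i := Fin.ext (by simp; omega)
    simp only [hi']
    rcases Int.units_eq_one_or (t i) with h | h <;> simp [h]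

/-- A finite family of rationals has a common positive denominator. -/
lemma exists_common_den {κ : Type*} [Fintype κ] (a : κ → ℚ) :
    ∃ (d : ℕ) (z : κ → ℤ), 0 < d ∧ ∀ k, (d : ℚ) * a k = z k := by
  have h : ∀ k, ∃ z : ℤ, ((∏ l, (a l).den : ℕ) : ℚ) * a k = z := by
    intro k
    obtain ⟨e, he⟩ := Finset.dvd_prod_of_mem (fun l => (a l).den) (Finset.mem_univ k)
    refine ⟨e * (a k).num, ?_⟩
    rw [he]
    push_cast
    rw [← Rat.mul_den_eq_num (a k)]
    ring
  choose z hz using h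
  exact ⟨_, z, Finset.prod_pos fun l _ => (a l).den_pos, hz⟩

/-- For `m ≥ 2` and every `a ∈ ℚ^(m(m-1)/2)`, there are `n ∈ ℕ`, a positive rational
`r`, and an `m × n` matrix `M` all of whose entries are `±r` and whose first row is
constantly `r` (so `M` is `m`-Hadamardesque), whose pairwise row dot products
realize `a`. -/
theorem exists_rational_hadamardesque_with_prescribed_rowdots (m : ℕ) (hm : 2 ≤ m)
    (a : Fin (m * (m - 1) / 2) → ℚ) :
    ∃ (n : ℕ) (r : ℚ) (M : Matrix (Fin m) (Fin n) ℝ),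
      0 < r ∧
      (∀ i k, M i k = (r : ℝ) ∨ M i k = -(r : ℝ)) ∧
      (∀ k, M ⟨0, by omega⟩ k = (r : ℝ)) ∧
      IsHadamardesque M ∧
      ∀ (i j : Fin m) (h : i < j),
        M i ⬝ᵥ M j = ((a ⟨pidx i j, pidx_lt h j.isLt⟩ : ℚ) : ℝ) := by
  obtain ⟨d, z, hd, hz⟩ := exists_common_den a
  obtain ⟨w, hw⟩ := exists_weight_signs fun i j : Fin m =>
    if h : i < j then 2 ^ m * d * z ⟨pidx i j, pidx_lt h j.isLt⟩ else 0
  let o : Fin m := ⟨0, by omega⟩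
  let e := Fintype.equivFin (Σ s : Fin m → ℤˣ, Fin (w s))
  let r : ℚ := 1 / (2 ^ m * d)
  have hdq : (0 : ℚ) < d := by exact_mod_cast hd
  have hr : 0 < r := by positivity
  have hrR : (0 : ℝ) < r := by exact_mod_cast hr
  let t : (Fin m → ℤˣ) → Fin m → ℤˣ := fun s i => s o * s i
  have ht : ∀ s, t s o = 1 := fun s => Int.units_mul_self _
  refine ⟨_, r, fun i k => r * ((t (e.symm k).1 i : ℤ) : ℝ), hr, fun i k => ?_, fun k => ?_,
    fun k => ?_, fun i j h => ?_⟩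
  · rcases Int.units_eq_one_or (t (e.symm k).1 i) with h | h <;> simp [h]
  · have := ht (e.symm k).1
    simp only [o] at this
    simp [this]
  · obtain ⟨c, hc⟩ := exists_Tmat_column (t (e.symm k).1) fun i hi => by
      rw [show i = o from Fin.ext hi, ht]
    exact ⟨r, c, hrR, fun i => by rw [hc]⟩
  · have htt : ∀ s, (t s i : ℤ) * t s j = s i * s j := by
      intro s
      simp only [t, ← Units.val_mul]
      rw [mul_mul_mul_comm, Int.units_mul_self, one_mul]
    have hsum := hw i j h
    rw [dif_pos h, Fintype.card_fin] at hsum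
    set k := (⟨pidx i j, pidx_lt h j.isLt⟩ : Fin (m * (m - 1) / 2))
    have hdot : ∑ x : (Σ s : Fin m → ℤˣ, Fin (w s)), ((t x.1 i : ℤ) * t x.1 j) =
        2 ^ m * (2 ^ m * d * z k) := by
      rw [← hsum, Fintype.sum_sigma]
      simp [htt]
    have hmul : ∀ x y : ℝ, (r * x) * (r * y) = r ^ 2 * (x * y) := fun x y => by ring
    simp only [dotProduct, hmul, ← Finset.mul_sum]
    rw [e.symm.sum_comp fun x => (((t x.1 i : ℤ) : ℝ) * ((t x.1 j : ℤ) : ℝ))]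
    have hq : r ^ 2 * ((2 ^ m * (2 ^ m * d * z k) : ℤ) : ℚ) = a k := by
      push_cast
      rw [← hz k]
      simp only [r]
      field_simp
    rw [← hq, ← hdot]
    push_cast
    rfl
end
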